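/- Suppose the DFP initialization satisfies σ_0 ≤ ε and ‖B̂_0 − I‖_F ≤ δ, where ε, δ > 0 are such that for some r ∈ (0, 1) both [4(2δ + 1)/(1 − ε)² + (3 + ε)/(1 − ε)]·ε/(1 − r) ≤ δ and ε + 2δ ≤ r/(1 + r). Then for every k ≥ 0: σ_{k+1} ≤ r·σ_k; ‖B̂_{k+1} − I‖_F ≤ 2δ; ‖B̂_k‖ ≤ 2δ + 1; and B̂_k is invertible with ‖B̂_k^{-1}‖ ≤ 1 + r. -/

import Mathlib

noncomputable section

open Matrix Finset

abbrev E (d : ℕ) := EuclideanSpace ℝ (Fin d)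
abbrev Mat (d : ℕ) := Matrix (Fin d) (Fin d) ℝ

/-- Spectral (operator 2-) norm of a real matrix. -/
def spec {d : ℕ} (A : Mat d) : ℝ := ‖Matrix.toEuclideanCLM (𝕜 := ℝ) A‖

/-- Frobenius norm of a real matrix. -/
def frob {d : ℕ} (A : Mat d) : ℝ := Real.sqrt (∑ i, ∑ j, (A i j) ^ 2)

/-- A matrix acting on a Euclidean vector. -/
def mApp {d : ℕ} (A : Mat d) (v : E d) : E d := Matrix.toEuclideanCLM (𝕜 := ℝ) A v

/-- Outer product `u vᵀ`. -/
def outer {d : ℕ} (u v : E d) : Mat d := Matrix.of fun i j => u i * v j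

/-- Euclidean dot product. -/
def dot {d : ℕ} (u v : E d) : ℝ := ∑ i, u i * v i

/-- `σ(x) = (M/μ^{3/2})·‖H_*^{1/2}(x − x_*)‖`. -/
def sig {d : ℕ} (M μ : ℝ) (sqH : Mat d) (xs x : E d) : ℝ :=
  M / μ ^ ((3:ℝ)/2) * ‖mApp sqH (x - xs)‖

/-- The DFP update of the Hessian approximation. -/
def dfpUpdate {d : ℕ} (B : Mat d) (s y : E d) : Mat d :=
  (1 - (dot y s)⁻¹ • outer y s) * B * (1 - (dot s y)⁻¹ • outer s y)
    + (dot y s)⁻¹ • outer y y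

section MatrixNorms

variable {d : ℕ}

lemma dot_eq_inner (u v : E d) : dot u v = inner ℝ u v := by
  simp [dot, PiLp.inner_apply, mul_comm]

lemma outer_eq_vecMulVec (u v : E d) : outer u v = vecMulVec u.ofLp v.ofLp := rfl

lemma ofLp_mApp (A : Mat d) (v : E d) : (mApp A v).ofLp = A *ᵥ v.ofLp := rfl

lemma mApp_mul (A B : Mat d) (v : E d) : mApp (A * B) v = mApp A (mApp B v) := by
  simp [mApp]

lemma mApp_sub (A : Mat d) (u v : E d) : mApp A (u - v) = mApp A u - mApp A v := by
  simp [mApp]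

lemma sub_mApp (A B : Mat d) (v : E d) : mApp (A - B) v = mApp A v - mApp B v := by
  simp [mApp]

lemma mApp_one (v : E d) : mApp 1 v = v := by
  simp [mApp]

lemma mApp_zero (A : Mat d) : mApp A 0 = 0 := by
  simp [mApp]

lemma spec_nonneg (A : Mat d) : 0 ≤ spec A := norm_nonneg _

lemma norm_mApp_le (A : Mat d) (v : E d) : ‖mApp A v‖ ≤ spec A * ‖v‖ :=
  ContinuousLinearMap.le_opNorm _ _

lemma spec_le {A : Mat d} {c : ℝ} (hc : 0 ≤ c) (h : ∀ v, ‖mApp A v‖ ≤ c * ‖v‖) : spec A ≤ c :=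
  ContinuousLinearMap.opNorm_le_bound _ hc h

lemma spec_mul_le (A B : Mat d) : spec (A * B) ≤ spec A * spec B := by
  simpa [spec] using norm_mul_le _ _

lemma spec_add_le (A B : Mat d) : spec (A + B) ≤ spec A + spec B := by
  simpa [spec] using norm_add_le _ _

lemma spec_one_le : spec (1 : Mat d) ≤ 1 :=
  spec_le zero_le_one fun v => by simp [mApp_one]

lemma spec_transpose (A : Mat d) : spec Aᵀ = spec A := by
  rw [spec, spec, ← norm_star (toEuclideanCLM (𝕜 := ℝ) A), ← map_star, star_eq_conjTranspose,
    conjTranspose_eq_transpose_of_trivial]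

section

attribute [local instance] Matrix.frobeniusNormedAddCommGroup Matrix.frobeniusNormedSpace

lemma frob_eq_norm (A : Mat d) : frob A = ‖A‖ := by
  simp [frob, frobenius_norm_def, Real.sqrt_eq_rpow]

lemma frob_add_le (A B : Mat d) : frob (A + B) ≤ frob A + frob B := by
  simpa [frob_eq_norm] using norm_add_le A B

lemma frob_neg (A : Mat d) : frob (-A) = frob A := by
  simp [frob_eq_norm]

lemma frob_smul (c : ℝ) (A : Mat d) : frob (c • A) = |c| * frob A := by
  simp [frob_eq_norm, norm_smul]

lemma frob_transpose (A : Mat d) : frob Aᵀ = frob A := by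
  simp [frob_eq_norm, frobenius_norm_transpose]

end

lemma frob_nonneg (A : Mat d) : 0 ≤ frob A := Real.sqrt_nonneg _

lemma sq_frob (A : Mat d) : frob A ^ 2 = ∑ j, ‖WithLp.toLp 2 (A.col j)‖ ^ 2 := by
  rw [frob, Real.sq_sqrt (by positivity), Finset.sum_comm]
  simp [EuclideanSpace.real_norm_sq_eq]

lemma frob_mul_le (A B : Mat d) : frob (A * B) ≤ spec A * frob B := by
  refine le_of_sq_le_sq ?_ (mul_nonneg (spec_nonneg A) (frob_nonneg B))
  rw [mul_pow, sq_frob, sq_frob, Finset.mul_sum]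
  refine Finset.sum_le_sum fun j _ => ?_
  rw [← mul_pow]
  refine pow_le_pow_left₀ (norm_nonneg _) ?_ 2
  exact norm_mApp_le A (WithLp.toLp 2 (B.col j))

lemma frob_mul_le' (A B : Mat d) : frob (A * B) ≤ frob A * spec B := by
  rw [← frob_transpose, transpose_mul, mul_comm, ← frob_transpose A, ← spec_transpose B]
  exact frob_mul_le _ _

lemma frob_outer (u v : E d) : frob (outer u v) = ‖u‖ * ‖v‖ := by
  rw [frob, EuclideanSpace.norm_eq, EuclideanSpace.norm_eq, ← Real.sqrt_mul (by positivity),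
    Finset.sum_mul_sum]
  simp [outer, mul_pow]

lemma mApp_outer (u v w : E d) : mApp (outer u v) w = dot v w • u := by
  ext i
  simp [ofLp_mApp, outer_eq_vecMulVec, vecMulVec_mulVec, dot, dotProduct, mul_comm]

lemma spec_outer_le (u v : E d) : spec (outer u v) ≤ ‖u‖ * ‖v‖ := by
  refine spec_le (by positivity) fun w => ?_
  rw [mApp_outer, norm_smul, dot_eq_inner]
  have := norm_inner_le_norm (𝕜 := ℝ) v w
  nlinarith [norm_nonneg u]

lemma spec_le_frob (A : Mat d) : spec A ≤ frob A := by
  refine spec_le (frob_nonneg A) fun v => ?_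
  refine le_of_sq_le_sq ?_ (mul_nonneg (frob_nonneg A) (norm_nonneg v))
  rw [mul_pow, frob, Real.sq_sqrt (by positivity), EuclideanSpace.real_norm_sq_eq,
    EuclideanSpace.real_norm_sq_eq, Finset.sum_mul]
  exact Finset.sum_le_sum fun i _ => by
    exact Finset.sum_mul_sq_le_sq_mul_sq univ (A i) v.ofLp

lemma isUnit_and_spec_inv_le {A : Mat d} {c : ℝ} (hc : 0 < c)
    (h : ∀ v, c * ‖v‖ ≤ ‖mApp A v‖) : IsUnit A ∧ spec A⁻¹ ≤ c⁻¹ := by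
  have hu : IsUnit A := by
    rw [← mulVec_injective_iff_isUnit]
    refine (injective_iff_map_eq_zero A.mulVecLin).2 fun v hv => ?_
    have h1 := h (WithLp.toLp 2 v)
    have h2 : mApp A (WithLp.toLp 2 v) = 0 := by
      ext i
      exact congrFun hv i
    rw [h2, norm_zero] at h1
    have h3 : ‖WithLp.toLp 2 v‖ = 0 := by nlinarith [norm_nonneg (WithLp.toLp 2 v)]
    simpa using h3
  refine ⟨hu, spec_le (by positivity) fun w => ?_⟩
  have h1 := h (mApp A⁻¹ w)
  rw [← mApp_mul, mul_nonsing_inv _ ((isUnit_iff_isUnit_det A).1 hu), mApp_one] at h1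
  rw [inv_mul_eq_div, le_div_iff₀ hc]
  linarith

lemma spec_one_sub_outer_le {u : E d} (hu : ‖u‖ = 1) : spec (1 - outer u u) ≤ 1 := by
  refine spec_le zero_le_one fun v => ?_
  rw [sub_mApp, mApp_one, mApp_outer, one_mul, dot_eq_inner]
  refine le_of_sq_le_sq ?_ (norm_nonneg v)
  rw [norm_sub_sq_real, norm_smul, inner_smul_right, hu, real_inner_comm]
  simp only [Real.norm_eq_abs, mul_one, sq_abs]
  nlinarith [sq_nonneg (inner ℝ u v)]

lemma mul_outer_mul (A C : Mat d) (u v : E d) :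
    A * outer u v * C = outer (mApp A u) (mApp Cᵀ v) := by
  simp [outer_eq_vecMulVec, mul_vecMulVec, vecMulVec_mul, ofLp_mApp, mulVec_transpose]

lemma dot_mApp (A : Mat d) (u v : E d) : dot (mApp A u) v = dot u (mApp Aᵀ v) := by
  change (A *ᵥ u.ofLp) ⬝ᵥ v.ofLp = u.ofLp ⬝ᵥ (Aᵀ *ᵥ v.ofLp)
  rw [dotProduct_mulVec, vecMul_transpose]

lemma dot_comm (u v : E d) : dot u v = dot v u := by
  simp [dot, mul_comm]

end MatrixNorms

section DFPUpdate

variable {d : ℕ}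

lemma norm_inv_dot_smul_sub_le {u v : E d} {τ : ℝ} (hu : ‖u‖ = 1) (hτ : τ < 1)
    (hv : ‖v - u‖ ≤ τ) : ‖(dot v u)⁻¹ • v - u‖ ≤ τ / (1 - τ) := by
  have huu : dot u u = 1 := by rw [dot_eq_inner, real_inner_self_eq_norm_sq, hu, one_pow]
  have hsub : dot u (v - u) = dot v u - 1 := by
    rw [dot_comm v, ← huu]
    simp only [dot_eq_inner, inner_sub_right]
  have hc : 1 - τ ≤ dot v u := by
    have h1 := abs_real_inner_le_norm u (v - u)
    rw [← dot_eq_inner, hsub, hu, one_mul] at h1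
    linarith [neg_abs_le (dot v u - 1)]
  have hτ0 : 0 < 1 - τ := by linarith
  have hc0 : 0 < dot v u := by linarith
  have hP : v - dot v u • u = mApp (1 - outer u u) (v - u) := by
    rw [sub_mApp, mApp_one, mApp_outer, hsub]
    module
  have h2 : (dot v u)⁻¹ • v - u = (dot v u)⁻¹ • (v - dot v u • u) := by
    rw [smul_sub, inv_smul_smul₀ hc0.ne']
  have h3 : ‖mApp (1 - outer u u) (v - u)‖ ≤ τ := by
    have := norm_mApp_le (1 - outer u u) (v - u)
    nlinarith [spec_one_sub_outer_le hu, norm_nonneg (v - u)]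
  rw [h2, hP, norm_smul, Real.norm_of_nonneg (by positivity), inv_mul_eq_div]
  exact div_le_div₀ ((norm_nonneg _).trans h3) h3 hτ0 hc

lemma frob_inv_dot_smul_outer_sub_le {u v : E d} {τ : ℝ} (hu : ‖u‖ = 1) (hτ : τ < 1)
    (hv : ‖v - u‖ ≤ τ) :
    frob ((dot v u)⁻¹ • outer v v - outer u u) ≤ (3 + τ) / (1 - τ) * τ := by
  have huu : dot u u = 1 := by rw [dot_eq_inner, real_inner_self_eq_norm_sq, hu, one_pow]
  have hc : |dot v u - 1| ≤ τ := by
    have h1 := abs_real_inner_le_norm u (v - u)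
    rw [← dot_eq_inner, hu, one_mul] at h1
    have hsub : dot u (v - u) = dot v u - 1 := by
      rw [dot_comm v, ← huu]
      simp only [dot_eq_inner, inner_sub_right]
    rw [← hsub]
    exact h1.trans hv
  have hτ0 : 0 < 1 - τ := by linarith
  have hc1 : 1 - τ ≤ dot v u := by linarith [neg_abs_le (dot v u - 1)]
  have hc0 : 0 < dot v u := by linarith
  have hτ1 : 0 ≤ τ := (norm_nonneg _).trans hv
  have hvn : ‖v‖ ≤ 1 + τ := by
    have := norm_add_le u (v - u)
    rw [add_sub_cancel] at this
    linarith
  have hinv : (dot v u)⁻¹ ≤ (1 - τ)⁻¹ := inv_anti₀ hτ0 hc1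
  have hdecomp : (dot v u)⁻¹ • outer v v - outer u u =
      (dot v u)⁻¹ • ((outer (v - u) v + outer u (v - u)) + (1 - dot v u) • outer u u) := by
    have h1 : outer (v - u) v + outer u (v - u) = outer v v - outer u u := by
      ext i j
      simp [outer]
      ring
    rw [h1, smul_add, smul_smul, mul_sub, inv_mul_cancel₀ hc0.ne']
    module
  have h2 : frob (outer (v - u) v + outer u (v - u)) ≤ τ * (1 + τ) + τ := by
    refine (frob_add_le _ _).trans ?_
    rw [frob_outer, frob_outer, hu, one_mul]
    gcongr
  have h3 : frob ((1 - dot v u) • outer u u) ≤ τ := by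
    rwa [frob_smul, frob_outer, hu, mul_one, mul_one, abs_sub_comm]
  rw [hdecomp, frob_smul, abs_of_pos (inv_pos.2 hc0)]
  calc _ ≤ (1 - τ)⁻¹ * (τ * (1 + τ) + τ + τ) := by
        gcongr
        · exact frob_nonneg _
        · exact (frob_add_le _ _).trans (add_le_add h2 h3)
    _ = _ := by ring

lemma frob_dfpUpdate_sub_one_le_of_norm_eq_one (B : Mat d) {u v : E d} {τ : ℝ} (hu : ‖u‖ = 1)
    (hτ : τ < 1) (hv : ‖v - u‖ ≤ τ) :
    frob (dfpUpdate B u v - 1) ≤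
      frob (B - 1) + (2 * spec B / (1 - τ) ^ 2 + (3 + τ) / (1 - τ)) * τ := by
  have huu : dot u u = 1 := by rw [dot_eq_inner, real_inner_self_eq_norm_sq, hu, one_pow]
  have hτ0 : 0 < 1 - τ := by linarith
  have hτ1 : 0 ≤ τ := (norm_nonneg _).trans hv
  set w := (dot v u)⁻¹ • v - u with hw
  set P := 1 - outer u u with hP
  set t := τ / (1 - τ) with ht
  have hPP : P * P = P := by
    have h1 : outer u u * outer u u = outer u u := by
      rw [outer_eq_vecMulVec, vecMulVec_mul_vecMulVec]
      change vecMulVec u.ofLp (dot u u • u.ofLp) = _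
      rw [huu, one_smul]
    rw [hP, mul_sub, sub_mul, sub_mul, h1]
    simp
  have hPs : spec P ≤ 1 := spec_one_sub_outer_le hu
  have hwt : ‖w‖ ≤ t := norm_inv_dot_smul_sub_le hu hτ hv
  have hQ : 1 - (dot u v)⁻¹ • outer u v = P - outer u w := by
    rw [dot_comm u v]
    ext i j
    simp [hP, hw, outer]
    ring
  have hQ' : 1 - (dot v u)⁻¹ • outer v u = P - outer w u := by
    ext i j
    simp [hP, hw, outer]
    ring
  have hdecomp : dfpUpdate B u v - 1 = P * ((B - 1) * P) + -(outer w u * (B * P))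
      + -(P * B * outer u w) + outer w u * (B * outer u w)
      + ((dot v u)⁻¹ • outer v v - outer u u) := by
    have h1 : outer u u = 1 - P := by rw [hP, sub_sub_cancel]
    have h2 : P * ((B - 1) * P) = P * B * P - P := by
      clear_value P
      rw [sub_mul, mul_sub, one_mul, hPP, mul_assoc]
    rw [dfpUpdate, hQ, hQ', h2, h1]
    noncomm_ring
  have hB := spec_nonneg B
  have hwu : frob (outer w u) ≤ t := by rwa [frob_outer, hu, mul_one]
  have huw : frob (outer u w) ≤ t := by rwa [frob_outer, hu, one_mul]
  have ht0 : 0 ≤ t := (norm_nonneg _).trans hwt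
  have e1 : frob (P * ((B - 1) * P)) ≤ frob (B - 1) := by
    calc _ ≤ spec P * (frob (B - 1) * spec P) :=
          (frob_mul_le _ _).trans (mul_le_mul_of_nonneg_left (frob_mul_le' _ _) (spec_nonneg _))
      _ ≤ 1 * (frob (B - 1) * 1) := by
          have := frob_nonneg (B - 1)
          have := spec_nonneg P
          gcongr
      _ = _ := by ring
  have e2 : frob (outer w u * (B * P)) ≤ t * spec B := by
    calc _ ≤ frob (outer w u) * (spec B * spec P) :=
          (frob_mul_le' _ _).trans (mul_le_mul_of_nonneg_left (spec_mul_le _ _) (frob_nonneg _))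
      _ ≤ t * (spec B * 1) := by
          have := spec_nonneg P
          gcongr
      _ = _ := by ring
  have e3 : frob (P * B * outer u w) ≤ spec B * t := by
    calc _ ≤ spec P * spec B * frob (outer u w) :=
          (frob_mul_le _ _).trans (mul_le_mul_of_nonneg_right (spec_mul_le _ _) (frob_nonneg _))
      _ ≤ 1 * spec B * t := by
          have := frob_nonneg (outer u w)
          gcongr
      _ = _ := by ring
  have e4 : frob (outer w u * (B * outer u w)) ≤ t * (spec B * t) := by
    calc _ ≤ frob (outer w u) * (spec B * frob (outer u w)) := by
          refine (frob_mul_le' _ _).trans (mul_le_mul_of_nonneg_left ?_ (frob_nonneg _))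
          exact (spec_mul_le _ _).trans (mul_le_mul_of_nonneg_left (spec_le_frob _) hB)
      _ ≤ _ := by
          have := frob_nonneg (outer u w)
          gcongr
  have e5 := frob_inv_dot_smul_outer_sub_le hu hτ hv
  have key : t * spec B + spec B * t + t * (spec B * t) ≤ 2 * spec B / (1 - τ) ^ 2 * τ := by
    have h1 : 2 * t + t ^ 2 ≤ 2 * τ / (1 - τ) ^ 2 := by
      have h2 : 2 * t + t ^ 2 = (2 * τ - τ ^ 2) / (1 - τ) ^ 2 := by
        rw [ht]
        field_simp
        ring
      rw [h2]
      gcongr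
      nlinarith
    calc _ = spec B * (2 * t + t ^ 2) := by ring
      _ ≤ spec B * (2 * τ / (1 - τ) ^ 2) := by gcongr
      _ = _ := by ring
  rw [hdecomp]
  refine (frob_add_le _ _).trans ?_
  have h4 := frob_add_le (P * ((B - 1) * P) + -(outer w u * (B * P))
      + -(P * B * outer u w)) (outer w u * (B * outer u w))
  have h5 := frob_add_le (P * ((B - 1) * P) + -(outer w u * (B * P))) (-(P * B * outer u w))
  have h6 := frob_add_le (P * ((B - 1) * P)) (-(outer w u * (B * P)))
  rw [frob_neg] at h5 h6
  rw [add_mul]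
  linarith

lemma dfpUpdate_smul_smul (B : Mat d) (s y : E d) {c : ℝ} (hc : c ≠ 0) :
    dfpUpdate B (c • s) (c • y) = dfpUpdate B s y := by
  have h (u v a b : E d) :
      (dot (c • u) (c • v))⁻¹ • outer (c • a) (c • b) = (dot u v)⁻¹ • outer a b := by
    have h1 : dot (c • u) (c • v) = c ^ 2 * dot u v := by
      simp only [dot_eq_inner, inner_smul_left, inner_smul_right]
      simp
      ring
    have h2 : outer (c • a) (c • b) = c ^ 2 • outer a b := by
      ext i j
      simp [outer]
      ring
    rw [h1, h2, smul_smul, mul_inv, mul_right_comm, inv_mul_cancel₀ (pow_ne_zero 2 hc), one_mul]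
  simp only [dfpUpdate, h]

lemma frob_dfpUpdate_sub_one_le (B : Mat d) {s y : E d} {τ : ℝ} (hs : s ≠ 0)
    (hτ : τ < 1) (hy : ‖y - s‖ ≤ τ * ‖s‖) :
    frob (dfpUpdate B s y - 1) ≤
      frob (B - 1) + (2 * spec B / (1 - τ) ^ 2 + (3 + τ) / (1 - τ)) * τ := by
  have hs0 : 0 < ‖s‖ := norm_pos_iff.2 hs
  rw [← dfpUpdate_smul_smul B s y (inv_ne_zero hs0.ne')]
  refine frob_dfpUpdate_sub_one_le_of_norm_eq_one B ?_ hτ ?_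
  · rw [norm_smul, norm_inv, norm_norm, inv_mul_cancel₀ hs0.ne']
  · rwa [← smul_sub, norm_smul, norm_inv, norm_norm, inv_mul_le_iff₀ hs0, mul_comm]

/-- The DFP update commutes with the change of variables `s ↦ S s`, `y ↦ S⁻¹ y`. -/
lemma inv_mul_dfpUpdate_mul_inv {S : Mat d} (hS : IsUnit S) (hST : Sᵀ = S) (B : Mat d)
    (s y : E d) :
    S⁻¹ * dfpUpdate B s y * S⁻¹ = dfpUpdate (S⁻¹ * B * S⁻¹) (mApp S s) (mApp S⁻¹ y) := by
  have hdet := (isUnit_iff_isUnit_det S).1 hS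
  have hST' : S⁻¹ᵀ = S⁻¹ := by rw [transpose_nonsing_inv, hST]
  have hSS : S⁻¹ * S = 1 := nonsing_inv_mul _ hdet
  have hSS' : S * S⁻¹ = 1 := mul_nonsing_inv _ hdet
  have hd : dot (mApp S s) (mApp S⁻¹ y) = dot s y := by
    rw [dot_mApp, hST, ← mApp_mul, hSS', mApp_one]
  have hd' : dot (mApp S⁻¹ y) (mApp S s) = dot y s := by rw [dot_comm, hd, dot_comm]
  have h1 : outer (mApp S⁻¹ y) (mApp S s) = S⁻¹ * outer y s * S := by rw [mul_outer_mul, hST]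
  have h2 : outer (mApp S s) (mApp S⁻¹ y) = S * outer s y * S⁻¹ := by rw [mul_outer_mul, hST']
  have h3 : outer (mApp S⁻¹ y) (mApp S⁻¹ y) = S⁻¹ * outer y y * S⁻¹ := by
    rw [mul_outer_mul, hST']
  have h4 : 1 - (dot y s)⁻¹ • (S⁻¹ * outer y s * S) =
      S⁻¹ * (1 - (dot y s)⁻¹ • outer y s) * S := by
    simp [mul_sub, sub_mul, hSS]
  have h5 : 1 - (dot s y)⁻¹ • (S * outer s y * S⁻¹) =
      S * (1 - (dot s y)⁻¹ • outer s y) * S⁻¹ := by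
    simp [mul_sub, sub_mul, hSS']
  rw [dfpUpdate, dfpUpdate, hd, hd', h1, h2, h3, h4, h5]
  generalize 1 - (dot y s)⁻¹ • outer y s = X
  generalize 1 - (dot s y)⁻¹ • outer s y = Y
  have h6 : S⁻¹ * X * S * (S⁻¹ * B * S⁻¹) * (S * Y * S⁻¹) =
      S⁻¹ * X * (S * S⁻¹) * B * (S⁻¹ * S) * Y * S⁻¹ := by noncomm_ring
  rw [h6, hSS, hSS', mul_one, mul_one, mul_add, add_mul]
  simp only [mul_assoc, mul_smul_comm, smul_mul_assoc]

end DFPUpdate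

section MeanValue

variable {d : ℕ}

lemma norm_inv_gradient_sub_sub_le {g : E d → E d} {Hess : E d → Mat d} {xs : E d} {μ M R : ℝ}
    {S : Mat d} (hμ : 0 < μ) (hM : 0 < M)
    (hHd : ∀ x, HasFDerivAt g (Matrix.toEuclideanCLM (𝕜 := ℝ) (Hess x)) x)
    (hLip : ∀ x, spec (Hess x - Hess xs) ≤ M * ‖x - xs‖)
    (hS : IsUnit S) (hSμ : spec S⁻¹ ≤ (√μ)⁻¹) (hSS : S * S = Hess xs) {a b : E d}
    (ha : ‖mApp S (a - xs)‖ ≤ R) (hb : ‖mApp S (b - xs)‖ ≤ R) :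
    ‖mApp S⁻¹ (g b - g a) - mApp S (b - a)‖ ≤
      M / μ ^ ((3 : ℝ) / 2) * R * ‖mApp S (b - a)‖ := by
  have hdet := (isUnit_iff_isUnit_det S).1 hS
  have hinv : S⁻¹ * S = 1 := nonsing_inv_mul _ hdet
  have hinv' : S * S⁻¹ = 1 := mul_nonsing_inv _ hdet
  have hR : 0 ≤ R := (norm_nonneg _).trans ha
  let T : E d →L[ℝ] E d := Matrix.toEuclideanCLM (𝕜 := ℝ) S⁻¹
  let ψ : E d → E d := fun z => T (g (xs + T z)) - z
  let H : E d → E d →L[ℝ] E d := fun z => Matrix.toEuclideanCLM (𝕜 := ℝ) (Hess (xs + T z))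
  have hψ (z : E d) : HasFDerivAt ψ (T ∘L (H z ∘L T) - ContinuousLinearMap.id ℝ (E d)) z := by
    have h1 : HasFDerivAt (fun z => xs + T z) T z := T.hasFDerivAt.const_add xs
    have h2 : HasFDerivAt (fun z => g (xs + T z)) (H z ∘L T) z := (hHd (xs + T z)).comp z h1
    exact (T.hasFDerivAt.comp z h2).sub (hasFDerivAt_id z)
  have hψ' (z : E d) : T ∘L (H z ∘L T) - ContinuousLinearMap.id ℝ (E d) =
      Matrix.toEuclideanCLM (𝕜 := ℝ) (S⁻¹ * (Hess (xs + T z) - Hess xs) * S⁻¹) := by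
    have h1 : S⁻¹ * (Hess (xs + T z) - Hess xs) * S⁻¹ = S⁻¹ * (Hess (xs + T z) * S⁻¹) - 1 := by
      rw [← hSS, mul_sub, sub_mul, ← mul_assoc S⁻¹ S S, hinv, one_mul, hinv', mul_assoc]
    rw [h1, map_sub, map_mul, map_mul, map_one]
    rfl
  have hpow : (√μ)⁻¹ * (M * ((√μ)⁻¹ * R)) * (√μ)⁻¹ = M / μ ^ ((3 : ℝ) / 2) * R := by
    have h1 : μ ^ ((3 : ℝ) / 2) = √μ ^ 3 := by
      rw [Real.sqrt_eq_rpow, ← Real.rpow_natCast, ← Real.rpow_mul hμ.le]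
      norm_num
    rw [h1]
    ring
  have hbound : ∀ z ∈ Metric.closedBall (0 : E d) R,
      ‖T ∘L (H z ∘L T) - ContinuousLinearMap.id ℝ (E d)‖ ≤ M / μ ^ ((3 : ℝ) / 2) * R := by
    intro z hz
    rw [mem_closedBall_zero_iff] at hz
    rw [hψ', ← hpow]
    change spec _ ≤ _
    refine (spec_mul_le _ _).trans ?_
    have h2 : spec (Hess (xs + T z) - Hess xs) ≤ M * ((√μ)⁻¹ * R) := by
      refine (hLip _).trans ?_
      rw [add_sub_cancel_left]
      have h3 : ‖T z‖ ≤ spec S⁻¹ * ‖z‖ := norm_mApp_le _ _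
      have h4 : spec S⁻¹ * ‖z‖ ≤ (√μ)⁻¹ * R := by gcongr
      gcongr
      exact h3.trans h4
    have h5 := (spec_mul_le S⁻¹ (Hess (xs + T z) - Hess xs)).trans
      (mul_le_mul hSμ h2 (spec_nonneg _) (by positivity))
    exact mul_le_mul h5 hSμ (spec_nonneg _) (by positivity)
  have hT (x : E d) : T (mApp S (x - xs)) = x - xs := by
    change mApp S⁻¹ (mApp S (x - xs)) = x - xs
    rw [← mApp_mul, hinv, mApp_one]
  have key := Convex.norm_image_sub_le_of_norm_hasFDerivWithin_le
    (fun z _ => (hψ z).hasFDerivWithinAt) hbound (convex_closedBall _ _)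
    (mem_closedBall_zero_iff.2 ha) (mem_closedBall_zero_iff.2 hb)
  have h1 : mApp S (b - xs) - mApp S (a - xs) = mApp S (b - a) := by
    rw [← mApp_sub, sub_sub_sub_cancel_right]
  have h2 : ψ (mApp S (b - xs)) - ψ (mApp S (a - xs)) =
      mApp S⁻¹ (g b - g a) - mApp S (b - a) := by
    simp only [ψ, hT, add_sub_cancel]
    rw [sub_sub_sub_comm, h1, ← map_sub]
    rfl
  rwa [h1, h2] at key

end MeanValue

theorem dfp_linear_convergence
    {d : ℕ}
    (f : E d → ℝ) (g : E d → E d) (Hess : E d → Mat d) (xs : E d)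
    (μ L M : ℝ) (hμ : 0 < μ) (hμL : μ ≤ L) (hM : 0 < M)
    -- `g` is the gradient of `f`, and `Hess` its Hessian (so `f` is twice differentiable)
    (hg : ∀ x, HasGradientAt f (g x) x)
    (hHd : ∀ x, HasFDerivAt g (Matrix.toEuclideanCLM (𝕜 := ℝ) (Hess x)) x)
    -- `xs` is the unique minimizer of `f`
    (hmin : ∀ x, f xs ≤ f x)
    (huniq : ∀ x, (∀ y, f x ≤ f y) → x = xs)
    -- Assumption 1: strong convexity and gradient Lipschitz continuity
    (hgl : ∀ x y, μ * ‖x - y‖ ≤ ‖g x - g y‖)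
    (hgu : ∀ x y, ‖g x - g y‖ ≤ L * ‖x - y‖)
    (hHl : ∀ x v, μ * ‖v‖ ^ 2 ≤ dot v (mApp (Hess x) v))
    (hHu : ∀ x v, dot v (mApp (Hess x) v) ≤ L * ‖v‖ ^ 2)
    -- Assumption 2: Hessian Lipschitz continuity toward the optimum
    (hLip : ∀ x, spec (Hess x - Hess xs) ≤ M * ‖x - xs‖)
    -- `sqH` is the positive definite square root `H_*^{1/2}` of `H_* = ∇²f(x_*)`
    (sqH : Mat d) (hsqH : sqH.PosDef) (hsqH2 : sqH * sqH = Hess xs)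
    -- the DFP method
    (x : ℕ → E d) (B : ℕ → Mat d)
    (hB0pd : (B 0).PosDef)
    (hxup : ∀ k, x (k+1) = x k - mApp (B k)⁻¹ (g (x k)))
    (hsne : ∀ k, x (k+1) - x k ≠ 0)
    (hBup : ∀ k, B (k+1) = dfpUpdate (B k) (x (k+1) - x k) (g (x (k+1)) - g (x k)))
    (ε δ r : ℝ) (hε : 0 < ε) (hδ : 0 < δ) (hr0 : 0 < r) (hr1 : r < 1)
    (hc1 : (4 * (2*δ + 1) / (1 - ε)^2 + (3 + ε) / (1 - ε)) * (ε / (1 - r)) ≤ δ)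
    (hc2 : ε + 2*δ ≤ r / (1 + r))
    (hσ0 : sig M μ sqH xs (x 0) ≤ ε)
    (hB0 : frob (sqH⁻¹ * B 0 * sqH⁻¹ - 1) ≤ δ) :
    ∀ k : ℕ,
      sig M μ sqH xs (x (k+1)) ≤ r * sig M μ sqH xs (x k) ∧
      frob (sqH⁻¹ * B (k+1) * sqH⁻¹ - 1) ≤ 2*δ ∧
      spec (sqH⁻¹ * B k * sqH⁻¹) ≤ 2*δ + 1 ∧
      IsUnit (sqH⁻¹ * B k * sqH⁻¹) ∧
      spec (sqH⁻¹ * B k * sqH⁻¹)⁻¹ ≤ 1 + r := by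
  have hSu : IsUnit sqH := hsqH.isUnit
  have hdet := (isUnit_iff_isUnit_det sqH).1 hSu
  have hST : sqHᵀ = sqH := by
    rw [← conjTranspose_eq_transpose_of_trivial, hsqH.isHermitian.eq]
  have hμs : 0 < √μ := Real.sqrt_pos.2 hμ
  have hSμ : spec sqH⁻¹ ≤ (√μ)⁻¹ := by
    refine (isUnit_and_spec_inv_le hμs fun v => ?_).2
    refine le_of_sq_le_sq ?_ (norm_nonneg _)
    rw [mul_pow, Real.sq_sqrt hμ.le, ← real_inner_self_eq_norm_sq (mApp sqH v), ← dot_eq_inner,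
      dot_mApp, hST, ← mApp_mul, hsqH2]
    exact hHl xs v
  -- the gradient vanishes at the minimizer
  have hgxs : g xs = 0 := by
    have hloc : IsLocalMin f xs := Filter.Eventually.of_forall hmin
    simpa using hloc.hasFDerivAt_eq_zero (hg xs).hasFDerivAt
  -- consequences of the parameter conditions
  have hr1' : 0 < 1 + r := by linarith
  have hrr : r / (1 + r) < 1 := (div_lt_one hr1').2 (by linarith)
  have hε1 : ε < 1 := by linarith
  set c := M / μ ^ ((3 : ℝ) / 2) with hc
  have hc0 : 0 < c := by positivity
  have hsig (z : E d) : sig M μ sqH xs z = c * ‖mApp sqH (z - xs)‖ := rfl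
  set C := 4 * (2 * δ + 1) / (1 - ε) ^ 2 + (3 + ε) / (1 - ε) with hC
  have hε1' : 0 < 1 - ε := by linarith
  have hC0 : 0 ≤ C := by positivity
  set Bh : ℕ → Mat d := fun k => sqH⁻¹ * B k * sqH⁻¹ with hBh
  -- one step of the method
  have hlow : ∀ k, frob (Bh k - 1) ≤ 2 * δ → ∀ v, (1 + r)⁻¹ * ‖v‖ ≤ ‖mApp (Bh k) v‖ := by
    intro k hk v
    have h1 : ‖mApp (Bh k - 1) v‖ ≤ 2 * δ * ‖v‖ := by
      refine (norm_mApp_le _ _).trans ?_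
      gcongr
      exact (spec_le_frob _).trans hk
    have h2 : ‖v‖ ≤ ‖mApp (Bh k) v‖ + ‖mApp (Bh k - 1) v‖ := by
      have := norm_sub_le (mApp (Bh k) v) (mApp (Bh k - 1) v)
      rwa [← sub_mApp, sub_sub_cancel, mApp_one] at this
    have h3 : (1 + r)⁻¹ = 1 - r / (1 + r) := by
      field_simp
      ring
    have h4 : 2 * δ * ‖v‖ ≤ r / (1 + r) * ‖v‖ := by
      gcongr
      linarith
    rw [h3]
    linarith
  have hBspec : ∀ k, frob (Bh k - 1) ≤ 2 * δ → spec (Bh k) ≤ 2 * δ + 1 := by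
    intro k hk
    have h1 := spec_add_le (Bh k - 1) 1
    rw [sub_add_cancel] at h1
    linarith [spec_le_frob (Bh k - 1), spec_one_le (d := d)]
  have hσstep : ∀ k, frob (Bh k - 1) ≤ 2 * δ → c * ‖mApp sqH (x k - xs)‖ ≤ ε →
      ‖mApp sqH (x (k + 1) - xs)‖ ≤ r * ‖mApp sqH (x k - xs)‖ := by
    intro k hk hσ
    have hBu : IsUnit (B k) := by
      have h1 : B k = sqH * Bh k * sqH := by
        have h2 : sqH * Bh k * sqH = (sqH * sqH⁻¹) * B k * (sqH⁻¹ * sqH) := by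
          simp only [hBh, mul_assoc]
        rw [h2, mul_nonsing_inv _ hdet, nonsing_inv_mul _ hdet, one_mul, mul_one]
      rw [h1]
      exact (hSu.mul (isUnit_and_spec_inv_le (inv_pos.2 hr1') (hlow k hk)).1).mul hSu
    have hG : ‖mApp sqH⁻¹ (g (x k)) - mApp sqH (x k - xs)‖ ≤ ε * ‖mApp sqH (x k - xs)‖ := by
      have h1 := norm_inv_gradient_sub_sub_le (a := xs) (b := x k) hμ hM hHd hLip hSu hSμ hsqH2
        (R := ‖mApp sqH (x k - xs)‖) (by simp [mApp_zero]) le_rfl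
      rw [hgxs, sub_zero] at h1
      refine h1.trans ?_
      gcongr
    have hnext : mApp (Bh k) (mApp sqH (x (k + 1) - xs)) =
        mApp (Bh k - 1) (mApp sqH (x k - xs)) -
          (mApp sqH⁻¹ (g (x k)) - mApp sqH (x k - xs)) := by
      have h1 : Bh k * sqH = sqH⁻¹ * B k := by
        rw [hBh, mul_assoc, nonsing_inv_mul _ hdet, mul_one]
      have h2 : mApp (Bh k) (mApp sqH (mApp (B k)⁻¹ (g (x k)))) = mApp sqH⁻¹ (g (x k)) := by
        rw [← mApp_mul, h1, ← mApp_mul, mul_assoc,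
          mul_nonsing_inv _ ((isUnit_iff_isUnit_det _).1 hBu), mul_one]
      rw [hxup, sub_right_comm, mApp_sub, mApp_sub, h2, sub_mApp, mApp_one]
      abel
    have h1 := hlow k hk (mApp sqH (x (k + 1) - xs))
    rw [hnext] at h1
    have h2 := h1.trans (norm_sub_le _ _)
    have h3 : ‖mApp (Bh k - 1) (mApp sqH (x k - xs))‖ ≤ 2 * δ * ‖mApp sqH (x k - xs)‖ := by
      refine (norm_mApp_le _ _).trans ?_
      gcongr
      exact (spec_le_frob _).trans hk
    have h4 : (1 + r)⁻¹ * ‖mApp sqH (x (k + 1) - xs)‖ ≤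
        r / (1 + r) * ‖mApp sqH (x k - xs)‖ := by
      have h5 : (ε + 2 * δ) * ‖mApp sqH (x k - xs)‖ ≤ r / (1 + r) * ‖mApp sqH (x k - xs)‖ := by
        gcongr
      linarith
    rwa [inv_mul_eq_div, div_mul_eq_mul_div, div_le_div_iff_of_pos_right hr1'] at h4
  have hBstep : ∀ k, frob (Bh k - 1) ≤ 2 * δ → c * ‖mApp sqH (x k - xs)‖ ≤ ε →
      frob (Bh (k + 1) - 1) ≤ frob (Bh k - 1) + C * (c * ‖mApp sqH (x k - xs)‖) := by
    intro k hk hσ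
    have hle : ‖mApp sqH (x (k + 1) - xs)‖ ≤ ‖mApp sqH (x k - xs)‖ :=
      (hσstep k hk hσ).trans (mul_le_of_le_one_left (norm_nonneg _) hr1.le)
    set σ := c * ‖mApp sqH (x k - xs)‖ with hσdef
    have hσ0 : 0 ≤ σ := by positivity
    have hy := norm_inv_gradient_sub_sub_le hμ hM hHd hLip hSu hSμ hsqH2 le_rfl hle
    rw [← hc, ← hσdef] at hy
    have hs : mApp sqH (x (k + 1) - x k) ≠ 0 := by
      intro h
      apply hsne k
      rw [← mApp_one (x (k + 1) - x k), ← nonsing_inv_mul _ hdet, mApp_mul, h, mApp_zero]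
    have h1 := frob_dfpUpdate_sub_one_le (Bh k) hs (hσ.trans_lt hε1) hy
    have h2 : Bh (k + 1) = dfpUpdate (Bh k) (mApp sqH (x (k + 1) - x k))
        (mApp sqH⁻¹ (g (x (k + 1)) - g (x k))) := by
      rw [← inv_mul_dfpUpdate_mul_inv hSu hST, ← hBup]
    rw [h2]
    refine h1.trans ?_
    have h3 : 2 * spec (Bh k) / (1 - σ) ^ 2 + (3 + σ) / (1 - σ) ≤ C := by
      have h4 := hBspec k hk
      have h5 := spec_nonneg (Bh k)
      rw [hC]
      gcongr
      norm_num
    gcongr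
  have h1r : 0 < 1 - r := by linarith
  have hbd : ∀ k : ℕ, δ + C * (ε * ((1 - r ^ k) / (1 - r))) ≤ 2 * δ := by
    intro k
    have h1 : C * (ε * ((1 - r ^ k) / (1 - r))) ≤ C * (ε * (1 / (1 - r))) := by
      have := pow_pos hr0 k
      gcongr
      linarith
    rw [mul_one_div] at h1
    linarith
  have hinv : ∀ k, c * ‖mApp sqH (x k - xs)‖ ≤ r ^ k * ε ∧
      frob (Bh k - 1) ≤ δ + C * (ε * ((1 - r ^ k) / (1 - r))) := by
    intro k
    induction k with
    | zero => simpa using ⟨hσ0, hB0⟩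
    | succ k ih =>
      obtain ⟨h1, h2⟩ := ih
      have h3 := h2.trans (hbd k)
      have h4 : c * ‖mApp sqH (x k - xs)‖ ≤ ε :=
        h1.trans (mul_le_of_le_one_left hε.le (pow_le_one₀ hr0.le hr1.le))
      refine ⟨?_, ?_⟩
      · calc _ ≤ c * (r * ‖mApp sqH (x k - xs)‖) := by
              gcongr
              exact hσstep k h3 h4
          _ = r * (c * ‖mApp sqH (x k - xs)‖) := by ring
          _ ≤ r * (r ^ k * ε) := by gcongr
          _ = _ := by ring
      · refine (hBstep k h3 h4).trans ?_
        have h5 : C * (c * ‖mApp sqH (x k - xs)‖) ≤ C * (r ^ k * ε) := by gcongr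
        have h6 : C * (ε * ((1 - r ^ (k + 1)) / (1 - r))) =
            C * (ε * ((1 - r ^ k) / (1 - r))) + C * (r ^ k * ε) := by
          field_simp
          ring
        linarith
  have hσε : ∀ k, c * ‖mApp sqH (x k - xs)‖ ≤ ε := fun k =>
    (hinv k).1.trans (mul_le_of_le_one_left hε.le (pow_le_one₀ hr0.le hr1.le))
  have hfrob : ∀ k, frob (Bh k - 1) ≤ 2 * δ := fun k => (hinv k).2.trans (hbd k)
  intro k
  obtain ⟨hu, hi⟩ := isUnit_and_spec_inv_le (inv_pos.2 hr1') (hlow k (hfrob k))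
  rw [inv_inv] at hi
  refine ⟨?_, hfrob (k + 1), hBspec k (hfrob k), hu, hi⟩
  rw [hsig, hsig, mul_left_comm]
  gcongr
  exact hσstep k (hfrob k) (hσε k)
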